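/- Let p be an odd prime. Then Σ_{x odd, 1 ≤ x ≤ p−1} x^{p−1} ≡ −1/2 + (p/2)·((pB_{p−1})_1 − (2N_{p−2})_0 + 1) (mod p^2). -/

import Mathlib

/-- The number of ascents of a permutation of `Fin n` (positions `i` with `σ i < σ (i+1)`). -/
def numAscents {n : ℕ} (σ : Equiv.Perm (Fin n)) : ℕ :=
  (Finset.univ.filter (fun i : Fin (n - 1) =>
    σ ⟨i.val, by have := i.isLt; omega⟩ < σ ⟨i.val + 1, by have := i.isLt; omega⟩)).card

/-- The number of permutations of `Fin n` with an even number of ascents. -/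
def evenAscentPerms (n : ℕ) : ℕ :=
  (Finset.univ.filter (fun σ : Equiv.Perm (Fin n) => Even (numAscents σ))).card

/-- The Eulerian number `E(n, m)`: permutations of `Fin n` with exactly `m` ascents. -/
def eulerian (n m : ℕ) : ℕ :=
  (Finset.univ.filter (fun σ : Equiv.Perm (Fin n) => numAscents σ = m)).card

/-- `x ≡ 0 (mod p^k)` for a rational `x`: either `x = 0` or the `p`-adic valuation
of `x` is at least `k`. -/
def PadicDvd (p k : ℕ) (x : ℚ) : Prop :=
  x = 0 ∨ (k : ℤ) ≤ padicValRat p x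

/-- The Agoh–Giuga quotient `(p·B_{p-1} + 1)/p`. -/
def agQuot (p : ℕ) : ℚ := ((p : ℚ) * bernoulli (p - 1) + 1) / p

/-- `(2N_{p-2})_0`: the first digit of the base-`p` expansion of `2·N_{p-2}`. -/
def digit0 (p : ℕ) : ℚ := ((2 * evenAscentPerms (p - 2)) % p : ℕ)

/-- `(2N_{p-2})_1`: the second digit of the base-`p` expansion of `2·N_{p-2}`. -/
def digit1 (p : ℕ) : ℚ := ((2 * evenAscentPerms (p - 2) / p) % p : ℕ)

lemma neg_one_pow_numAscents {R : Type*} [CommRing R] {n : ℕ} (σ : Equiv.Perm (Fin (n + 1))) :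
    (-1 : R) ^ numAscents σ = ∏ i : Fin n, if σ i.castSucc < σ i.succ then -1 else 1 := by
  rw [Finset.prod_ite, Finset.prod_const, Finset.prod_const_one, mul_one]
  rfl

/-- The permutation with first value `j` whose remaining values are in the same relative order as
those of `τ`. -/
def consPerm {n : ℕ} (j : Fin (n + 1)) (τ : Equiv.Perm (Fin n)) : Equiv.Perm (Fin (n + 1)) :=
  ((finSuccEquiv' 0).trans (Equiv.optionCongr τ)).trans (finSuccEquiv' j).symm

@[simp]
lemma consPerm_zero {n : ℕ} (j : Fin (n + 1)) (τ : Equiv.Perm (Fin n)) : consPerm j τ 0 = j := by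
  simp [consPerm]

@[simp]
lemma consPerm_succ {n : ℕ} (j : Fin (n + 1)) (τ : Equiv.Perm (Fin n)) (i : Fin n) :
    consPerm j τ i.succ = j.succAbove (τ i) := by
  have h : finSuccEquiv' 0 i.succ = some i := by
    rw [← Fin.succAbove_zero_apply, finSuccEquiv'_succAbove]
  simp [consPerm, h]

lemma consPerm_bijective (n : ℕ) :
    Function.Bijective
      (fun x : Fin (n + 1) × Equiv.Perm (Fin n) => consPerm x.1 x.2) := by
  rw [Fintype.bijective_iff_injective_and_card]
  refine ⟨?_, by simp [Fintype.card_perm, Nat.factorial_succ]⟩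
  rintro ⟨j, τ⟩ ⟨j', τ'⟩ h
  obtain rfl : j = j' := by simpa using DFunLike.congr_fun h 0
  refine Prod.ext rfl (Equiv.ext fun i => ?_)
  simpa using DFunLike.congr_fun h i.succ

lemma neg_one_pow_numAscents_consPerm {R : Type*} [CommRing R] {n : ℕ} (j : Fin (n + 2))
    (τ : Equiv.Perm (Fin (n + 1))) :
    (-1 : R) ^ numAscents (consPerm j τ) =
      (if (j : ℕ) ≤ τ 0 then -1 else 1) * (-1) ^ numAscents τ := by
  simp_rw [neg_one_pow_numAscents, Fin.prod_univ_succ, Fin.castSucc_zero, consPerm_zero,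
    ← Fin.succ_castSucc, consPerm_succ, Fin.succAbove_lt_succAbove_iff,
    Fin.lt_succAbove_iff_le_castSucc, Fin.le_def, Fin.val_castSucc]

lemma sum_ite_mul_succ_pow_mul_pow {R : Type*} [CommRing R] (x : R) (m j : ℕ) (hj : j ≤ m + 1) :
    ∑ i ∈ Finset.range (m + 1), (if j ≤ i then -1 else 1) * ((x + 1) ^ i * x ^ (m - i)) =
      2 * ((x + 1) ^ j * x ^ (m + 1 - j)) - (x ^ (m + 1) + (x + 1) ^ (m + 1)) := by
  induction j with
  | zero =>
    have h := geom_sum₂_mul (x + 1) x (m + 1)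
    simp only [add_sub_cancel_left, mul_one, add_tsub_cancel_right] at h
    simp only [zero_le, if_true, neg_mul, one_mul, Finset.sum_neg_distrib, h, pow_zero,
      Nat.sub_zero]
    ring
  | succ j ih =>
    have hstep : ∀ i, (if j + 1 ≤ i then (-1 : R) else 1) * ((x + 1) ^ i * x ^ (m - i)) =
        (if j ≤ i then -1 else 1) * ((x + 1) ^ i * x ^ (m - i)) +
          if j = i then 2 * ((x + 1) ^ i * x ^ (m - i)) else 0 := by
      intro i
      rcases lt_trichotomy j i with h | rfl | h
      · simp [h.le, h.ne, Nat.succ_le_of_lt h]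
      · simp; ring
      · simp [h.not_ge, h.ne', show ¬ j + 1 ≤ i by omega]
    simp_rw [hstep]
    rw [Finset.sum_add_distrib, ih (by omega), Finset.sum_ite_eq,
      if_pos (Finset.mem_range.2 (by omega)), show m + 1 - j = (m - j) + 1 by omega,
      show m + 1 - (j + 1) = m - j by omega]
    ring

/-- A closed form, modulo an odd number `p`, of the sum of `(-1) ^ numAscents σ` over the
permutations `σ` of `Fin (m + 1)` with first value `j`. -/
def signedAscentSum (p m j : ℕ) : ZMod p :=
  2 ^ m * ∑ k ∈ Finset.range p, ((k : ZMod p) + 1) ^ j * (k : ZMod p) ^ (m - j) * (-1) ^ k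

lemma sum_alternating_pow_add_succ_pow (p m : ℕ) :
    ∑ k ∈ Finset.range p,
      ((k : ZMod p) ^ (m + 1) + ((k : ZMod p) + 1) ^ (m + 1)) * (-1) ^ k = 0 := by
  have h := Finset.sum_range_sub (fun k : ℕ => -((k : ZMod p) ^ (m + 1) * (-1) ^ k)) p
  simp only [CharP.cast_eq_zero, Nat.cast_zero, ne_eq, Nat.add_eq_zero_iff, one_ne_zero,
    and_false, not_false_eq_true, zero_pow, zero_mul, neg_zero, sub_zero] at h
  rw [← h]
  refine Finset.sum_congr rfl fun k _ => ?_
  push_cast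
  ring

lemma sum_ite_mul_signedAscentSum (p : ℕ) {m j : ℕ} (hj : j ≤ m + 1) :
    ∑ i ∈ Finset.range (m + 1), (if j ≤ i then -1 else 1) * signedAscentSum p m i =
      signedAscentSum p (m + 1) j := by
  have h := sum_alternating_pow_add_succ_pow p m
  simp only [signedAscentSum]
  calc _ = 2 ^ m * ∑ k ∈ Finset.range p, (∑ i ∈ Finset.range (m + 1),
          (if j ≤ i then -1 else 1) * (((k : ZMod p) + 1) ^ i * (k : ZMod p) ^ (m - i))) *
            (-1) ^ k := by
        simp_rw [Finset.sum_mul, Finset.mul_sum]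
        rw [Finset.sum_comm]
        exact Finset.sum_congr rfl fun k _ => Finset.sum_congr rfl fun i _ => by ring
    _ = 2 ^ m * ∑ k ∈ Finset.range p,
          (2 * (((k : ZMod p) + 1) ^ j * (k : ZMod p) ^ (m + 1 - j) * (-1) ^ k) -
            ((k : ZMod p) ^ (m + 1) + ((k : ZMod p) + 1) ^ (m + 1)) * (-1) ^ k) := by
        congr 1
        refine Finset.sum_congr rfl fun k _ => ?_
        rw [sum_ite_mul_succ_pow_mul_pow _ _ _ hj]
        ring
    _ = _ := by
        rw [Finset.sum_sub_distrib, h, ← Finset.mul_sum]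
        ring

lemma sum_apply_zero_mul_neg_one_pow_numAscents {p : ℕ} (hp : Odd p) (m : ℕ)
    (f : ℕ → ZMod p) :
    ∑ σ : Equiv.Perm (Fin (m + 1)), f (σ 0) * (-1) ^ numAscents σ =
      ∑ j ∈ Finset.range (m + 1), f j * signedAscentSum p m j := by
  induction m generalizing f with
  | zero =>
    simp [neg_one_pow_numAscents, signedAscentSum, neg_one_geom_sum, Nat.not_even_iff_odd.2 hp]
  | succ m ih =>
    rw [← (consPerm_bijective (m + 1)).sum_comp, Fintype.sum_prod_type, Finset.sum_comm]
    simp only [consPerm_zero, neg_one_pow_numAscents_consPerm, ← mul_assoc, ← Finset.sum_mul]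
    have h := ih fun i => ∑ j ∈ Finset.range (m + 2), f j * if j ≤ i then -1 else 1
    simp only [← Fin.sum_univ_eq_sum_range _ (m + 2)] at h
    rw [h]
    simp_rw [Finset.sum_mul]
    rw [Finset.sum_comm, ← Fin.sum_univ_eq_sum_range _ (m + 1 + 1)]
    refine Finset.sum_congr rfl fun j _ => ?_
    rw [← sum_ite_mul_signedAscentSum p (Nat.lt_succ_iff.1 j.isLt),
      Finset.mul_sum]
    exact Finset.sum_congr rfl fun i _ => by ring

lemma sum_neg_one_pow_numAscents {p : ℕ} (hp : Odd p) (m : ℕ) :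
    ∑ σ : Equiv.Perm (Fin (m + 1)), (-1 : ZMod p) ^ numAscents σ =
      -2 ^ (m + 1) * ∑ k ∈ Finset.range p, (k : ZMod p) ^ (m + 1) * (-1) ^ k := by
  have h := sum_apply_zero_mul_neg_one_pow_numAscents hp m 1
  have h' := sum_alternating_pow_add_succ_pow p m
  have h'' := sum_ite_mul_signedAscentSum p (le_refl (m + 1))
  simp only [Pi.one_apply, one_mul] at h
  rw [h]
  rw [Finset.sum_congr rfl fun i hi => by
    rw [if_neg (by simpa using hi), one_mul]] at h''
  rw [h'']
  simp only [add_mul, Finset.sum_add_distrib] at h'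
  simp only [signedAscentSum, Nat.sub_self, pow_zero, mul_one]
  linear_combination 2 ^ (m + 1) * h'

lemma two_mul_evenAscentPerms {R : Type*} [CommRing R] (n : ℕ) :
    2 * (evenAscentPerms n : R) =
      n.factorial + ∑ σ : Equiv.Perm (Fin n), (-1 : R) ^ numAscents σ := by
  have h : ∀ σ : Equiv.Perm (Fin n),
      (2 : R) * (if Even (numAscents σ) then 1 else 0) = 1 + (-1 : R) ^ numAscents σ := by
    intro σ
    split_ifs with h
    · rw [h.neg_one_pow]; ring
    · rw [(Nat.not_even_iff_odd.1 h).neg_one_pow]; ring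
  rw [evenAscentPerms, Finset.card_filter]
  push_cast
  simp_rw [Finset.mul_sum, h, Finset.sum_add_distrib]
  simp [Fintype.card_perm]

lemma sum_Icc_eq_sum_odd_add_sub {M : Type*} [AddCommMonoid M] {p : ℕ} (hp : Odd p) (f : ℕ → M) :
    ∑ x ∈ Finset.Icc 1 (p - 1), f x =
      ∑ x ∈ (Finset.Icc 1 (p - 1)).filter (fun x => Odd x), (f x + f (p - x)) := by
  rw [← Finset.sum_filter_add_sum_filter_not _ (fun x => Odd x), Finset.sum_add_distrib]
  congr 1
  refine Finset.sum_nbij' (p - ·) (p - ·) ?_ ?_ ?_ ?_ ?_ <;>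
    simp only [Finset.mem_filter, Finset.mem_Icc, Nat.not_odd_iff_even] <;>
    rintro x ⟨⟨h1, h2⟩, h⟩
  · exact ⟨by omega, Nat.Odd.sub_even (by omega) hp h⟩
  · exact ⟨by omega, Nat.Odd.sub_odd hp h⟩
  · omega
  · omega
  · rw [show p - (p - x) = x by omega]

lemma sum_odd_pow_sub_two {p : ℕ} (hp : p.Prime) (hodd : Odd p) :
    ∑ x ∈ (Finset.Icc 1 (p - 1)).filter (fun x => Odd x), (x : ZMod p) ^ (p - 2) =
      2 * evenAscentPerms (p - 2) - 1 := by
  have : Fact p.Prime := ⟨hp⟩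
  have hp3 : 3 ≤ p := by
    have := hp.two_le
    obtain ⟨n, rfl⟩ := hodd
    omega
  obtain ⟨m, rfl⟩ : ∃ m, p = m + 3 := ⟨p - 3, by omega⟩
  have h2 : (2 : ZMod (m + 3)) ≠ 0 := by
    intro h
    have h' : ((2 : ℕ) : ZMod (m + 3)) = 0 := by exact_mod_cast h
    rw [ZMod.natCast_eq_zero_iff] at h'
    exact absurd (Nat.le_of_dvd two_pos h') (by omega)
  have hfermat : (2 : ZMod (m + 3)) ^ (m + 2) = 1 := ZMod.pow_card_sub_one_eq_one h2
  have hfact : ((m + 1).factorial : ZMod (m + 3)) = 1 := by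
    have h := ZMod.wilsons_lemma (m + 3)
    rw [show m + 3 - 1 = m + 1 + 1 by omega, Nat.factorial_succ] at h
    have h0 : ((m + 3 : ℕ) : ZMod (m + 3)) = 0 := ZMod.natCast_self _
    push_cast at h h0
    linear_combination ((m + 1).factorial : ZMod (m + 3)) * h0 - h
  have hm : Odd (m + 1) := by
    rw [Nat.odd_iff] at hodd ⊢
    omega
  have hsum : ∑ k ∈ Finset.range (m + 3), (k : ZMod (m + 3)) ^ (m + 1) * (-1) ^ k =
      -2 * ∑ x ∈ (Finset.Icc 1 (m + 3 - 1)).filter (fun x => Odd x),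
        (x : ZMod (m + 3)) ^ (m + 1) := by
    rw [Finset.range_eq_Ico, Finset.sum_eq_sum_Ico_succ_bot (by omega)]
    rw [show Finset.Ico (0 + 1) (m + 3) = Finset.Icc 1 (m + 3 - 1) by ext; simp; omega]
    rw [sum_Icc_eq_sum_odd_add_sub hodd, Finset.mul_sum]
    simp only [Nat.cast_zero, ne_eq, Nat.add_eq_zero_iff, one_ne_zero, and_false,
      not_false_eq_true, zero_pow, zero_mul, zero_add]
    refine Finset.sum_congr rfl fun x hx => ?_
    rw [Finset.mem_filter, Finset.mem_Icc] at hx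
    rw [Nat.cast_sub (by omega), ZMod.natCast_self, zero_sub, hm.neg_pow, hx.2.neg_one_pow,
      (Nat.Odd.sub_odd hodd hx.2).neg_one_pow]
    ring
  rw [show m + 3 - 2 = m + 1 by omega, two_mul_evenAscentPerms, hfact,
    sum_neg_one_pow_numAscents hodd, hsum]
  linear_combination -(∑ x ∈ (Finset.Icc 1 (m + 3 - 1)).filter (fun x => Odd x),
        (x : ZMod (m + 3)) ^ (m + 1)) * hfermat

lemma inv_natCast_mem_integer {p : ℕ} [hp : Fact p.Prime] {n : ℕ} (h0 : n ≠ 0) (h : n < p) :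
    (n : ℚ)⁻¹ ∈ (Rat.padicValuation p).integer := by
  rw [Valuation.mem_integer_iff, Rat.padicValuation_le_one_iff,
    Rat.inv_natCast_den_of_pos (Nat.pos_of_ne_zero h0)]
  exact Nat.not_dvd_of_pos_of_lt (Nat.pos_of_ne_zero h0) h

lemma bernoulli_mem_integer {p : ℕ} [Fact p.Prime] {n : ℕ} (h : n + 1 < p) :
    bernoulli n ∈ (Rat.padicValuation p).integer := by
  induction n using Nat.strong_induction_on with
  | _ n ih =>
    have hs := sum_bernoulli (n + 1)
    rw [Finset.sum_range_succ, Nat.choose_succ_self_right] at hs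
    have hB : bernoulli n = ((if n + 1 = 1 then 1 else 0) -
        ∑ k ∈ Finset.range n, ((n + 1).choose k : ℚ) * bernoulli k) * ((n + 1 : ℕ) : ℚ)⁻¹ := by
      rw [← hs]
      field_simp
      ring
    rw [hB]
    refine mul_mem (sub_mem ?_ (sum_mem fun k hk => ?_))
      (inv_natCast_mem_integer n.succ_ne_zero h)
    · split_ifs
      exacts [one_mem _, zero_mem _]
    · rw [Finset.mem_range] at hk
      exact mul_mem (natCast_mem _ _) (ih k hk (by omega))

lemma sum_pow_sub_one_sub_mul_bernoulli {p : ℕ} [hp : Fact p.Prime] (hp3 : 3 ≤ p) :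
    ∃ y ∈ (Rat.padicValuation p).integer,
      ∑ x ∈ Finset.Icc 1 (p - 1), (x : ℚ) ^ (p - 1) - p * bernoulli (p - 1) = p ^ 2 * y := by
  have hp0 : (p : ℚ) ≠ 0 := by exact_mod_cast hp.out.ne_zero
  have hF := sum_range_pow p (p - 1)
  rw [Finset.range_eq_Ico, Finset.sum_eq_sum_Ico_succ_bot (by omega),
    show Finset.Ico (0 + 1) p = Finset.Icc 1 (p - 1) by ext; simp; omega, Nat.cast_zero,
    zero_pow (by omega), zero_add, Finset.sum_range_succ,
    Nat.sub_add_cancel (by omega), ← Nat.cast_add_one, Nat.sub_add_cancel (by omega),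
    show p - (p - 1) = 1 by omega, Nat.choose_symm (by omega : 1 ≤ p)] at hF
  have hterm : ∀ i ∈ Finset.range (p - 1), ∃ y ∈ (Rat.padicValuation p).integer,
      bernoulli i * (p.choose i) * (p : ℚ) ^ (p - i) / p = p ^ 2 * y := by
    intro i hi
    rw [Finset.mem_range] at hi
    rcases Nat.eq_zero_or_pos i with rfl | hi0
    · refine ⟨(p : ℚ) ^ (p - 3), pow_mem (natCast_mem _ _) _, ?_⟩
      rw [div_eq_iff hp0, Nat.sub_zero, bernoulli_zero, Nat.choose_zero_right, Nat.cast_one,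
        one_mul, one_mul, ← pow_add, ← pow_succ]
      congr 1
      omega
    · obtain ⟨c, hc⟩ := hp.out.dvd_choose_self hi0.ne' (by omega)
      refine ⟨bernoulli i * c * (p : ℚ) ^ (p - i - 2), mul_mem (mul_mem
        (bernoulli_mem_integer (by omega)) (natCast_mem _ _)) (pow_mem (natCast_mem _ _) _), ?_⟩
      rw [hc, div_eq_iff hp0, show p - i = p - i - 2 + 2 by omega]
      push_cast
      ring
  choose! y hy hy' using hterm
  refine ⟨∑ i ∈ Finset.range (p - 1), y i, sum_mem hy, ?_⟩
  rw [hF, Finset.sum_congr rfl hy', Finset.mul_sum]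
  simp
  field_simp
  ring

lemma exists_add_sub_pow_sub_one (p x : ℤ) {n : ℕ} (hn : Even (n + 1)) :
    ∃ c : ℤ, x ^ (n + 1) + (p - x) ^ (n + 1) =
      2 * x ^ (n + 1) - (n + 1) * p * x ^ n + p ^ 2 * c := by
  obtain ⟨k, hk⟩ := Polynomial.powAddExpansion x (-p) (n + 1)
  refine ⟨k, ?_⟩
  rw [← hn.neg_pow (p - x), neg_sub, sub_eq_add_neg x p, hk, Nat.add_sub_cancel]
  push_cast
  ring

lemma padicDvd_pow_mul {p : ℕ} [hp : Fact p.Prime] (k : ℕ) {y : ℚ}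
    (hy : y ∈ (Rat.padicValuation p).integer) : PadicDvd p k (p ^ k * y) := by
  by_cases hy0 : y = 0
  · exact Or.inl (by simp [hy0])
  right
  have hp0 : (p : ℚ) ≠ 0 := by exact_mod_cast hp.out.ne_zero
  rw [Valuation.mem_integer_iff, Rat.padicValuation_le_one_iff] at hy
  rw [padicValRat.mul (pow_ne_zero _ hp0) hy0, padicValRat.pow p, padicValRat.self hp.out.one_lt,
    padicValRat_def, padicValNat.eq_zero_of_not_dvd hy]
  simp

theorem sum_odd_powers_p_sub_one_mod_p_sq
    (p : ℕ) (hp : p.Prime) (hodd : Odd p) :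
    PadicDvd p 2 ((∑ x ∈ (Finset.Icc 1 (p - 1)).filter (fun x => Odd x), (x : ℚ) ^ (p - 1)) -
      (-(1 / 2) + ((p : ℚ) / 2) * (agQuot p - digit0 p + 1))) := by
  have : Fact p.Prime := ⟨hp⟩
  have hp3 : 3 ≤ p := by
    have := hp.two_le
    obtain ⟨n, rfl⟩ := hodd
    omega
  have hp0 : (p : ℚ) ≠ 0 := by exact_mod_cast hp.ne_zero
  obtain ⟨y, hy, hyB⟩ := sum_pow_sub_one_sub_mul_bernoulli hp3
  obtain ⟨d, hd⟩ : (p : ℤ) ∣ (∑ x ∈ (Finset.Icc 1 (p - 1)).filter (fun x => Odd x),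
      (x : ℤ) ^ (p - 2)) + 1 - ((2 * evenAscentPerms (p - 2) % p : ℕ) : ℤ) := by
    rw [← ZMod.intCast_zmod_eq_zero_iff_dvd]
    push_cast
    rw [sum_odd_pow_sub_two hp hodd]
    simp
  have hc : ∀ x : ℕ, ∃ c : ℤ, (x : ℤ) ^ (p - 1) + (p - x) ^ (p - 1) =
      2 * x ^ (p - 1) + p * x ^ (p - 2) + p ^ 2 * c := by
    intro x
    have he : Even (p - 2 + 1) := by
      rw [Nat.odd_iff] at hodd
      rw [Nat.even_iff]
      omega
    obtain ⟨c, hc⟩ := exists_add_sub_pow_sub_one p x he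
    rw [Nat.cast_sub (by omega), show p - 2 + 1 = p - 1 by omega] at hc
    refine ⟨c - x ^ (p - 2), ?_⟩
    rw [hc]
    push_cast
    ring
  choose c hc using hc
  have hsum : ∑ x ∈ Finset.Icc 1 (p - 1), (x : ℚ) ^ (p - 1) =
      ∑ x ∈ (Finset.Icc 1 (p - 1)).filter (fun x => Odd x),
        (2 * (x : ℚ) ^ (p - 1) + p * (x : ℚ) ^ (p - 2) + p ^ 2 * c x) := by
    rw [sum_Icc_eq_sum_odd_add_sub hodd]
    refine Finset.sum_congr rfl fun x hx => ?_
    rw [Finset.mem_filter, Finset.mem_Icc] at hx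
    rw [Nat.cast_sub (by omega)]
    exact_mod_cast hc x
  rw [Finset.sum_add_distrib, Finset.sum_add_distrib, ← Finset.mul_sum, ← Finset.mul_sum,
    ← Finset.mul_sum] at hsum
  have hdQ : (∑ x ∈ (Finset.Icc 1 (p - 1)).filter (fun x => Odd x), (x : ℚ) ^ (p - 2)) + 1 -
      digit0 p = p * d := by
    rw [digit0]
    exact_mod_cast hd
  convert padicDvd_pow_mul (p := p) 2 (y := ((2 : ℕ) : ℚ)⁻¹ *
    (y - ∑ x ∈ (Finset.Icc 1 (p - 1)).filter (fun x => Odd x), (c x : ℚ) - d)) ?_ using 1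
  · have hag : (p : ℚ) * agQuot p = p * bernoulli (p - 1) + 1 := by
      rw [agQuot]
      field_simp
    push_cast
    linear_combination (1 / 2 : ℚ) * hyB - (1 / 2 : ℚ) * hsum - (p / 2 : ℚ) * hdQ -
      (1 / 2 : ℚ) * hag
  · exact mul_mem (inv_natCast_mem_integer two_ne_zero (by omega))
      (sub_mem (sub_mem hy (sum_mem fun x _ => intCast_mem _ _)) (intCast_mem _ _))
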